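/- arXiv:2401.12450 — 3 statements merged into one kernel-verified Lean document; each statement's English description precedes it below -/
import Mathlib

section
/- Let G be a finite group. If the Chermak–Delgado measure m_G is increasing on the centralizer lattice C(G) (i.e., for all C, D ∈ C(G) with C ≤ D one has m_G(C) ≤ m_G(D)), then G is nilpotent. -/
/-- The Chermak–Delgado measure of a subgroup `H` of `G`: `|H| * |C_G(H)|`. -/
noncomputable def cdMeasure (G : Type*) [Group G] (H : Subgroup G) : ℕ :=
  Nat.card H * Nat.card (Subgroup.centralizer (H : Set G))

/-- The Chermak–Delgado lattice of `G`: subgroups of maximal Chermak–Delgado measure. -/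
def cdLattice (G : Type*) [Group G] : Set (Subgroup G) :=
  {H | ∀ K : Subgroup G, cdMeasure G K ≤ cdMeasure G H}

/-- The centralizer lattice of `G`: subgroups that are centralizers of subgroups. -/
def centLattice (G : Type*) [Group G] : Set (Subgroup G) :=
  {C | ∃ H : Subgroup G, C = Subgroup.centralizer (H : Set G)}

open Pointwise

namespace Subgroup

variable {G : Type*} [Group G]

theorem card_mul_card_le_ncard_mul [Finite G] (A B : Subgroup G) :
    Nat.card A * Nat.card B ≤ ((A : Set G) * (B : Set G)).ncard * Nat.card (A ⊓ B : Subgroup G) := by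
  have hfac : ∀ x : ((A : Set G) * (B : Set G) : Set G), ∃ a ∈ A, ∃ b ∈ B, a * b = x.1 :=
    fun x ↦ x.2
  choose f hfA e heB hfe using hfac
  let x (u : A × B) : ((A : Set G) * (B : Set G) : Set G) :=
    ⟨u.1 * u.2, Set.mul_mem_mul u.1.2 u.2.2⟩
  have hmem (u : A × B) : (f (x u))⁻¹ * u.1 ∈ A ⊓ B := by
    refine ⟨mul_mem (A.inv_mem (hfA _)) u.1.2, ?_⟩
    have h : (f (x u))⁻¹ * u.1 = e (x u) * (u.2 : G)⁻¹ := by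
      rw [inv_mul_eq_iff_eq_mul, ← mul_assoc, hfe, eq_mul_inv_iff_mul_eq]
    rw [h]
    exact mul_mem (heB _) (B.inv_mem u.2.2)
  rw [← Nat.card_prod, ← Nat.card_coe_set_eq, ← Nat.card_prod]
  refine Nat.card_le_card_of_injective
    (fun u ↦ (x u, (⟨(f (x u))⁻¹ * u.1, hmem u⟩ : (A ⊓ B : Subgroup G)))) fun u v huv ↦ ?_
  obtain ⟨hx, hy⟩ := Prod.ext_iff.mp huv
  simp only at hx hy
  have h1 : (u.1 : G) = v.1 := by
    have := congrArg Subtype.val hy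
    simpa only [hx, mul_right_inj] using this
  have h2 : (u.1 : G) * u.2 = v.1 * v.2 := congrArg Subtype.val hx
  rw [h1, mul_right_inj] at h2
  exact Prod.ext (Subtype.ext h1) (Subtype.ext h2)

theorem conj_smul_le_of_le_normalizer {H K : Subgroup G} (hK : K ≤ normalizer (H : Set G)) {k : G}
    (hk : k ∈ K) : MulAut.conj k • H ≤ H := by
  rintro _ ⟨y, hy, rfl⟩
  exact (mem_normalizer_iff.mp (hK hk) y).mp hy

theorem le_normalizer_of_forall_conj_smul_le {H K : Subgroup G}
    (h : ∀ k ∈ K, MulAut.conj k • H ≤ H) : K ≤ normalizer (H : Set G) := by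
  intro k hk
  refine mem_normalizer_iff.mpr fun y ↦ ⟨fun hy ↦ h k hk ⟨y, hy, rfl⟩, fun hy ↦ ?_⟩
  have := h k⁻¹ (inv_mem hk) ⟨_, hy, rfl⟩
  simpa [mul_assoc] using this

theorem le_normalizer_sup {H A B : Subgroup G} (hA : H ≤ normalizer (A : Set G))
    (hB : H ≤ normalizer (B : Set G)) : H ≤ normalizer ((A ⊔ B : Subgroup G) : Set G) := by
  refine le_normalizer_of_forall_conj_smul_le fun k hk ↦ ?_
  rw [smul_sup]
  exact sup_le_sup (conj_smul_le_of_le_normalizer hA hk) (conj_smul_le_of_le_normalizer hB hk)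

theorem mem_of_coe_eq_mul_conj_smul {A B : Subgroup G} {g : G} (hg : g ∈ B)
    (h : (B : Set G) = (A : Set G) * ((MulAut.conj g • A : Subgroup G) : Set G)) : g ∈ A := by
  have hg' : g⁻¹ ∈ (B : Set G) := inv_mem hg
  rw [h] at hg'
  obtain ⟨a, ha, _, ⟨b, hb, rfl⟩, hab⟩ := hg'
  have hab' : a * (g * b * g⁻¹) = g⁻¹ := hab
  have : g = a⁻¹ * b⁻¹ := by
    rw [← mul_assoc, ← mul_assoc, mul_eq_right, ← eq_inv_iff_mul_eq_one] at hab'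
    rw [← hab', inv_mul_cancel_left]
  rw [this]
  exact mul_mem (inv_mem ha) (inv_mem hb)

/-- A `p`-subgroup which is normal in a subnormal subgroup lies in a normal `p`-subgroup. -/
theorem IsSubnormal.exists_normal_isPGroup_ge [Finite G] {p : ℕ} {H : Subgroup G}
    (hH : H.IsSubnormal) {Q : Subgroup G} (hQ : IsPGroup p Q) (hQH : Q ≤ H)
    (hn : H ≤ normalizer (Q : Set G)) : ∃ R : Subgroup G, R.Normal ∧ IsPGroup p R ∧ Q ≤ R := by
  induction hH generalizing Q with
  | top => exact ⟨Q, normalizer_eq_top_iff.mp (top_le_iff.mp hn), hQ, le_rfl⟩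
  | step H K hHK _ hN ih =>
    rw [normal_subgroupOf_iff_le_normalizer hHK] at hN
    obtain ⟨S, hQS, hS⟩ := Set.Finite.exists_le_maximal
      (Set.toFinite {S : Subgroup G | IsPGroup p S ∧ S ≤ H ∧ H ≤ normalizer (S : Set G)})
      (a := Q) ⟨hQ, hQH, hn⟩
    obtain ⟨hSp, hSH, hSn⟩ := hS.prop
    have hKS : K ≤ normalizer (S : Set G) := by
      refine le_normalizer_of_forall_conj_smul_le fun k hk ↦ ?_
      have hp : IsPGroup p (MulAut.conj k • S : Subgroup G) := hSp.map _
      have hle : MulAut.conj k • S ≤ H :=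
        (pointwise_smul_le_pointwise_smul_iff.mpr hSH).trans (conj_smul_le_of_le_normalizer hN hk)
      have hnorm : H ≤ normalizer ((MulAut.conj k • S : Subgroup G) : Set G) := by
        refine le_normalizer_of_forall_conj_smul_le fun g hg ↦ ?_
        have hg' : k⁻¹ * g * k ∈ H := by
          have := conj_smul_le_of_le_normalizer hN (inv_mem hk) ⟨g, hg, rfl⟩
          simpa using this
        have := conj_smul_le_of_le_normalizer hSn hg'
        rw [← pointwise_smul_le_pointwise_smul_iff (a := MulAut.conj k), smul_smul, ← map_mul,
          show k * (k⁻¹ * g * k) = g * k by group, map_mul, ← smul_smul] at this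
        exact this
      have hmem : (S ⊔ MulAut.conj k • S) ∈
          {S : Subgroup G | IsPGroup p S ∧ S ≤ H ∧ H ≤ normalizer (S : Set G)} :=
        ⟨hSp.to_sup_of_normal_right' hp (hSH.trans hnorm), sup_le hSH hle,
          le_normalizer_sup hSn hnorm⟩
      exact le_sup_right.trans (hS.le_of_ge hmem le_sup_left)
    obtain ⟨R, hR, hRp, hSR⟩ := ih hSp (hSH.trans hHK) hKS
    exact ⟨R, hR, hRp, hQS.trans hSR⟩

theorem isMulCommutative_centralizer_centralizer_singleton (x : G) :
    IsMulCommutative (centralizer (centralizer ({x} : Set G) : Set G)) := by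
  rw [← le_centralizer_iff_isMulCommutative]
  refine centralizer_le (centralizer_le ?_)
  rw [Set.singleton_subset_iff, SetLike.mem_coe, mem_centralizer_singleton_iff]

/-- A finite group in which all double centralizers of elements are subnormal is nilpotent. -/
theorem _root_.Group.isNilpotent_of_isSubnormal_centralizer_centralizer [Finite G]
    (h : ∀ x : G, (centralizer (centralizer ({x} : Set G) : Set G)).IsSubnormal) :
    Group.IsNilpotent G := by
  refine (Group.isNilpotent_of_finite_tfae.out 0 3 rfl rfl).mpr fun p _ P ↦ ⟨fun x hx g ↦ ?_⟩
  have := isMulCommutative_centralizer_centralizer_singleton x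
  set A := centralizer (centralizer ({x} : Set G) : Set G)
  have hxA : x ∈ A := Set.subset_centralizer_centralizer (Set.mem_singleton x)
  have hzA : zpowers x ≤ A := zpowers_le.mpr hxA
  have hzP : IsPGroup p (zpowers x) := P.isPGroup'.to_le (zpowers_le.mpr hx)
  obtain ⟨R, hR, hRp, hzR⟩ := (h x).exists_normal_isPGroup_ge hzP hzA
    ((le_centralizer A).trans ((centralizer_le hzA).trans (centralizer_le_normalizer _)))
  exact hRp.le_sylow_of_normal P (hR.conj_mem x (hzR (mem_zpowers x)) g)

end Subgroup

section CDLattice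

open Subgroup

variable {G : Type*} [Group G] [Finite G]

theorem conj_smul_mem_cdLattice {A : Subgroup G} (hA : A ∈ cdLattice G) (g : G) :
    MulAut.conj g • A ∈ cdLattice G := by
  intro K
  refine (hA K).trans (Nat.mul_le_mul (Nat.card_congr (equivSMul _ A).toEquiv).le ?_)
  calc Nat.card (centralizer (A : Set G))
      = Nat.card (MulAut.conj g • centralizer (A : Set G) : Subgroup G) :=
        Nat.card_congr (equivSMul _ _).toEquiv
    _ ≤ _ := card_le_of_le (map_centralizer_le_centralizer_image _ _)

theorem sup_mem_cdLattice_and_coe_sup_eq_mul {A B : Subgroup G} (hA : A ∈ cdLattice G)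
    (hB : B ∈ cdLattice G) :
    A ⊔ B ∈ cdLattice G ∧ ((A ⊔ B : Subgroup G) : Set G) = (A : Set G) * (B : Set G) := by
  set A' := centralizer (A : Set G)
  set B' := centralizer (B : Set G)
  have hmul (H K : Subgroup G) : (H : Set G) * (K : Set G) ⊆ (H ⊔ K : Subgroup G) := by
    rintro _ ⟨a, ha, b, hb, rfl⟩
    exact mul_mem_sup ha hb
  have hle (H K : Subgroup G) :
      ((H : Set G) * (K : Set G)).ncard ≤ Nat.card (H ⊔ K : Subgroup G) :=
    (Set.ncard_le_ncard (hmul H K) (Set.toFinite _)).trans_eq (Nat.card_coe_set_eq _).symm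
  have hAB := card_mul_card_le_ncard_mul A B
  have hAB' := card_mul_card_le_ncard_mul A' B'
  have hinf := hA (A ⊓ B)
  have hsup := hA (A ⊔ B)
  have hBA := hB A
  have hcinf : Nat.card (A' ⊔ B' : Subgroup G) ≤
      Nat.card (centralizer ((A ⊓ B : Subgroup G) : Set G)) :=
    card_le_of_le (sup_le (centralizer_le inf_le_left) (centralizer_le inf_le_right))
  have hcsup : Nat.card (A' ⊓ B' : Subgroup G) ≤
      Nat.card (centralizer ((A ⊔ B : Subgroup G) : Set G)) := by
    refine card_le_of_le (le_centralizer_iff.mp (sup_le ?_ ?_))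
    · exact le_centralizer_iff.mp inf_le_left
    · exact le_centralizer_iff.mp inf_le_right
  have hs := hle A B
  have hs' := (hle A' B').trans hcinf
  have hi : 0 < Nat.card (A ⊓ B : Subgroup G) := Nat.card_pos
  have hj : 0 < Nat.card (A' ⊓ B' : Subgroup G) := Nat.card_pos
  have hm : 0 < cdMeasure G A := Nat.mul_pos Nat.card_pos Nat.card_pos
  have hmA : cdMeasure G A = Nat.card A * Nat.card A' := rfl
  have hmB : cdMeasure G B = Nat.card B * Nat.card B' := rfl
  have hminf : Nat.card (A ⊓ B : Subgroup G) * ((A' : Set G) * (B' : Set G)).ncard ≤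
      cdMeasure G A := (Nat.mul_le_mul_left _ hs').trans hinf
  have hmsup : Nat.card (A ⊔ B : Subgroup G) * Nat.card (A' ⊓ B' : Subgroup G) ≤
      cdMeasure G A := (Nat.mul_le_mul_left _ hcsup).trans hsup
  have key : cdMeasure G A * cdMeasure G A ≤
      (((A : Set G) * (B : Set G)).ncard * Nat.card (A' ⊓ B' : Subgroup G)) * cdMeasure G A := by
    calc cdMeasure G A * cdMeasure G A ≤ cdMeasure G A * cdMeasure G B :=
          Nat.mul_le_mul_left _ hBA
      _ = (Nat.card A * Nat.card B) * (Nat.card A' * Nat.card B') := by rw [hmA, hmB]; ring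
      _ ≤ _ := Nat.mul_le_mul hAB hAB'
      _ = (((A : Set G) * (B : Set G)).ncard * Nat.card (A' ⊓ B' : Subgroup G)) *
          (Nat.card (A ⊓ B : Subgroup G) * ((A' : Set G) * (B' : Set G)).ncard) := by ring
      _ ≤ _ := Nat.mul_le_mul_left _ hminf
  have key' := Nat.le_of_mul_le_mul_right key hm
  constructor
  · exact fun K ↦ (hA K).trans (key'.trans (Nat.mul_le_mul hs hcsup))
  · refine (Set.eq_of_subset_of_ncard_le (hmul A B) ?_ (Set.toFinite _)).symm
    rw [← Nat.card_coe_set_eq]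
    exact Nat.le_of_mul_le_mul_right (hmsup.trans key') hj

theorem isSubnormal_of_mem_cdLattice (htop : ⊤ ∈ cdLattice G) {A : Subgroup G}
    (hA : A ∈ cdLattice G) : A.IsSubnormal := by
  induction A using WellFoundedGT.induction with
  | ind A ih =>
    obtain rfl | hne := eq_or_ne A ⊤
    · exact .top
    obtain ⟨B, -, hB⟩ := Set.Finite.exists_le_minimal
      (Set.toFinite {B : Subgroup G | B ∈ cdLattice G ∧ A < B}) (a := ⊤) ⟨htop, hne.lt_top⟩
    obtain ⟨hBL, hAB⟩ := hB.prop
    refine .step A B hAB.le (ih B hAB hBL) ?_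
    rw [normal_subgroupOf_iff_le_normalizer hAB.le]
    refine le_normalizer_of_forall_conj_smul_le fun g hg ↦ ?_
    by_contra hn
    obtain ⟨hL, hmul⟩ := sup_mem_cdLattice_and_coe_sup_eq_mul hA (conj_smul_mem_cdLattice hA g)
    have hle : A ⊔ MulAut.conj g • A ≤ B := sup_le hAB.le <|
      (pointwise_smul_le_pointwise_smul_iff.mpr hAB.le).trans
        (conj_smul_le_of_le_normalizer le_normalizer hg)
    have heq : B = A ⊔ MulAut.conj g • A :=
      le_antisymm (hB.le_of_le ⟨hL, left_lt_sup.mpr hn⟩ hle) hle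
    rw [← heq] at hmul
    exact hn (conj_smul_le_of_le_normalizer le_normalizer (mem_of_coe_eq_mul_conj_smul hg hmul))

theorem cdMeasure_le_cdMeasure_centralizer (H : Subgroup G) :
    cdMeasure G H ≤ cdMeasure G (centralizer (H : Set G)) := by
  rw [cdMeasure, cdMeasure, mul_comm]
  exact Nat.mul_le_mul_left _ (card_le_of_le (le_centralizer_iff.mp le_rfl))

theorem centLattice_subset_cdLattice
    (h : ∀ C D : Subgroup G, C ∈ centLattice G → D ∈ centLattice G → C ≤ D →
      cdMeasure G C ≤ cdMeasure G D) : centLattice G ⊆ cdLattice G := by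
  have htop : (⊤ : Subgroup G) ∈ centLattice G :=
    ⟨center G, centralizer_center.symm⟩
  have hle_top {C : Subgroup G} (hC : C ∈ centLattice G) : cdMeasure G C ≤ cdMeasure G ⊤ :=
    h C ⊤ hC htop le_top
  rintro _ ⟨H, rfl⟩ K
  calc cdMeasure G K ≤ cdMeasure G (centralizer (K : Set G)) :=
        cdMeasure_le_cdMeasure_centralizer K
    _ ≤ cdMeasure G ⊤ := hle_top ⟨K, rfl⟩
    _ ≤ cdMeasure G (centralizer ((⊤ : Subgroup G) : Set G)) :=
        cdMeasure_le_cdMeasure_centralizer ⊤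
    _ ≤ cdMeasure G (centralizer (H : Set G)) :=
        h _ _ ⟨⊤, rfl⟩ ⟨H, rfl⟩ (centralizer_le (Set.subset_univ _))

end CDLattice

theorem nilpotent_of_cd_measure_increasing_on_centralizers (G : Type*) [Group G] [Finite G]
    (h : ∀ C D : Subgroup G, C ∈ centLattice G → D ∈ centLattice G → C ≤ D →
      cdMeasure G C ≤ cdMeasure G D) :
    Group.IsNilpotent G := by
  have hsub := centLattice_subset_cdLattice h
  refine Group.isNilpotent_of_isSubnormal_centralizer_centralizer fun x ↦ ?_
  exact isSubnormal_of_mem_cdLattice (hsub ⟨_, Subgroup.centralizer_center.symm⟩) (hsub ⟨_, rfl⟩)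
end

section
/- Let G be a finite group and let P be a set of subgroups of G on which the Chermak–Delgado measure m_G is increasing (i.e., for all H, K ∈ P with H ≤ K one has m_G(H) ≤ m_G(K)). Suppose C is an abelian subgroup of G with C ∈ C(G) (C is a centralizer of some subgroup), C ∈ P, and C_G(C) ∈ P. If some X ∈ P with C ≤ X ≤ C_G(C) belongs to CD(G), then every X ∈ P with C ≤ X ≤ C_G(C) belongs to CD(G). -/
theorem centralizer_centralizer_of_mem_centLattice {G : Type*} [Group G] {C : Subgroup G}
    (hC : C ∈ centLattice G) :
    Subgroup.centralizer (Subgroup.centralizer (C : Set G) : Set G) = C := by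
  obtain ⟨H, rfl⟩ := hC
  exact SetLike.coe_injective (Set.centralizer_centralizer_centralizer (H : Set G))

theorem cdMeasure_centralizer {G : Type*} [Group G] {C : Subgroup G}
    (hC : C ∈ centLattice G) :
    cdMeasure G (Subgroup.centralizer (C : Set G)) = cdMeasure G C := by
  rw [cdMeasure, cdMeasure, centralizer_centralizer_of_mem_centLattice hC, mul_comm]

theorem interval_subset_cd_lattice (G : Type*) [Group G] [Finite G]
    (P : Set (Subgroup G))
    (hinc : ∀ H K : Subgroup G, H ∈ P → K ∈ P → H ≤ K →
      cdMeasure G H ≤ cdMeasure G K)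
    (C : Subgroup G) (hab : ∀ x ∈ C, ∀ y ∈ C, x * y = y * x)
    (hcent : C ∈ centLattice G) (hCP : C ∈ P)
    (hCC : Subgroup.centralizer (C : Set G) ∈ P)
    (hex : ∃ X ∈ P, C ≤ X ∧ X ≤ Subgroup.centralizer (C : Set G) ∧ X ∈ cdLattice G) :
    ∀ X ∈ P, C ≤ X → X ≤ Subgroup.centralizer (C : Set G) → X ∈ cdLattice G := by
  obtain ⟨Y, hYP, hCY, hYC, hY⟩ := hex
  intro X hXP hCX hXC K
  calc cdMeasure G K ≤ cdMeasure G Y := hY K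
    _ ≤ cdMeasure G (Subgroup.centralizer (C : Set G)) := hinc _ _ hYP hCC hYC
    _ = cdMeasure G C := cdMeasure_centralizer hcent
    _ ≤ cdMeasure G X := hinc _ _ hCP hXP hCX
end

section
/- Let G be a finite group and let k be the number of positive divisors of |Z(G)|. If the Chermak–Delgado measure m_G is increasing on the subgroup lattice of G (i.e., for all subgroups H ≤ K of G one has m_G(H) ≤ m_G(K)), then the image of m_G has cardinality exactly k; in fact the image equals {n·|G| : n divides |Z(G)|}. -/
theorem Subgroup.card_sup_mul_card_inf {G : Type*} [Group G] (H K : Subgroup G) [K.Normal] :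
    Nat.card ↥(H ⊔ K) * Nat.card ↥(H ⊓ K) = Nat.card H * Nat.card K := by
  have hsup := relIndex_mul_relIndex ⊥ K (H ⊔ K) bot_le le_sup_right
  have hinf := relIndex_mul_relIndex ⊥ (H ⊓ K) H bot_le inf_le_left
  rw [relIndex_sup_right, relIndex_bot_left, relIndex_bot_left] at hsup
  rw [inf_relIndex_left, relIndex_bot_left, relIndex_bot_left] at hinf
  rw [← hsup, ← hinf]
  ring

/-- The converse of Lagrange's theorem for finite commutative groups. -/
theorem CommGroup.exists_subgroup_card_eq_of_dvd {A : Type*} [CommGroup A] [Finite A] {n : ℕ}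
    (hn : n ∣ Nat.card A) : ∃ H : Subgroup A, Nat.card H = n := by
  induction n using Nat.recOnPrimeCoprime with
  | zero => exact absurd (zero_dvd_iff.mp hn) Nat.card_pos.ne'
  | prime_pow p k hp =>
    have : Fact p.Prime := ⟨hp⟩
    exact Sylow.exists_subgroup_card_pow_prime p hn
  | coprime a b _ _ hab iha ihb =>
    obtain ⟨H, rfl⟩ := iha (dvd_of_mul_right_dvd hn)
    obtain ⟨K, rfl⟩ := ihb (dvd_of_mul_left_dvd hn)
    refine ⟨H ⊔ K, ?_⟩
    rw [← Subgroup.card_sup_mul_card_inf, (Subgroup.disjoint_of_coprime_natCard hab).eq_bot,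
      Subgroup.card_bot, mul_one]

theorem cdMeasure_of_le_center {G : Type*} [Group G] {H : Subgroup G}
    (hH : H ≤ Subgroup.center G) : cdMeasure G H = Nat.card H * Nat.card G := by
  rw [cdMeasure, Subgroup.centralizer_eq_top_iff_subset.mpr hH, Subgroup.card_top]

theorem cdMeasure_top (G : Type*) [Group G] :
    cdMeasure G ⊤ = Nat.card G * Nat.card (Subgroup.center G) := by
  rw [cdMeasure, Subgroup.coe_top, Subgroup.centralizer_univ, Subgroup.card_top]

theorem centralizer_sup_center {G : Type*} [Group G] (H : Subgroup G) :
    Subgroup.centralizer ((H ⊔ Subgroup.center G : Subgroup G) : Set G) =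
      Subgroup.centralizer (H : Set G) := by
  refine le_antisymm (Subgroup.centralizer_le (SetLike.coe_subset_coe.mpr le_sup_left)) ?_
  rw [Subgroup.le_centralizer_iff]
  exact sup_le (Subgroup.le_centralizer_iff.mp le_rfl) (Subgroup.center_le_centralizer _)

/-- If the Chermak–Delgado measure is increasing, then `m_G(H) = |H ∩ Z(G)| * |G|`. -/
theorem cdMeasure_eq_card_inf_center_mul_of_increasing {G : Type*} [Group G] [Finite G]
    (hinc : ∀ H K : Subgroup G, H ≤ K → cdMeasure G H ≤ cdMeasure G K) (H : Subgroup G) :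
    cdMeasure G H = Nat.card ↥(H ⊓ Subgroup.center G) * Nat.card G := by
  refine le_antisymm ?_ ?_
  · have htop := hinc (H ⊔ Subgroup.center G) ⊤ le_top
    rw [cdMeasure_top, cdMeasure, centralizer_sup_center] at htop
    have hcard := H.card_sup_mul_card_inf (Subgroup.center G)
    refine Nat.le_of_mul_le_mul_right (c := Nat.card (Subgroup.center G)) ?_ Nat.card_pos
    calc cdMeasure G H * Nat.card (Subgroup.center G)
        = Nat.card ↥(H ⊓ Subgroup.center G) * (Nat.card ↥(H ⊔ Subgroup.center G) *
            Nat.card (Subgroup.centralizer (H : Set G))) := by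
          rw [cdMeasure, mul_right_comm, ← hcard]
          ring
      _ ≤ Nat.card ↥(H ⊓ Subgroup.center G) *
            (Nat.card G * Nat.card (Subgroup.center G)) := by gcongr
      _ = _ := (mul_assoc _ _ _).symm
  · rw [← cdMeasure_of_le_center inf_le_right]
    exact hinc _ _ inf_le_left

theorem image_cd_measure_card_eq_of_increasing (G : Type*) [Group G] [Finite G]
    (hinc : ∀ H K : Subgroup G, H ≤ K → cdMeasure G H ≤ cdMeasure G K) :
    (Set.range (cdMeasure G)).ncard = (Nat.card (Subgroup.center G)).divisors.card ∧
      Set.range (cdMeasure G) =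
        {m : ℕ | ∃ n : ℕ, n ∣ Nat.card (Subgroup.center G) ∧ m = n * Nat.card G} := by
  have hrange : Set.range (cdMeasure G) =
      {m : ℕ | ∃ n : ℕ, n ∣ Nat.card (Subgroup.center G) ∧ m = n * Nat.card G} := by
    ext m
    constructor
    · rintro ⟨H, rfl⟩
      exact ⟨_, Subgroup.card_dvd_of_le inf_le_right,
        cdMeasure_eq_card_inf_center_mul_of_increasing hinc H⟩
    · rintro ⟨n, hn, rfl⟩
      open scoped IsMulCommutative in
      obtain ⟨K, rfl⟩ := CommGroup.exists_subgroup_card_eq_of_dvd hn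
      refine ⟨K.map (Subgroup.center G).subtype, ?_⟩
      rw [cdMeasure_of_le_center (Subgroup.map_subtype_le K),
        Subgroup.card_map_of_injective (Subgroup.subtype_injective _)]
  refine ⟨?_, hrange⟩
  have himage : Set.range (cdMeasure G) =
      (· * Nat.card G) '' ((Nat.card (Subgroup.center G)).divisors : Set ℕ) := by
    rw [hrange]
    ext m
    simp [Nat.card_pos.ne', eq_comm]
  rw [himage, Set.ncard_image_of_injective _ (mul_left_injective₀ Nat.card_pos.ne'),
    Set.ncard_coe_finset]
end
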